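/- (Residue formula for Type III row polynomials.) Assume β = 0 and β' ≠ 0. Fix x > 0 and n ∈ ℕ, and define f : ℝ → ℝ by f(z) = z^{γ'/β'−1}·exp(−γ/(β'·z))·(z−x)^{n+1}/(Q(z)−Q(x))^{n+1} (real powers; with Lean's conventions Real.rpow and division-by-zero = 0 this defines f totally, and Q(z) is defined by the same series for z > 0). Then the n-th derivative of f has a limit as z → x within z ≠ x, namely: Filter.Tendsto (iteratedDeriv n f) (𝓝[≠] x) (𝓝 (β'·x^{1+((n+1)·α'+γ')/β'}·exp(−((n+1)·α+γ)/(β'·x))·P_n(x))). -/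

import Mathlib

open Filter Topology Set

/-- Leibniz rule for a product with the linear factor `z - x`, evaluated at `x`. -/
theorem iteratedDeriv_succ_sub_mul_self {w : ℝ → ℝ} {x : ℝ} (hw : AnalyticAt ℝ w x) (n : ℕ) :
    iteratedDeriv (n + 1) (fun z => (z - x) * w z) x = (n + 1) * iteratedDeriv n w x := by
  induction n generalizing w with
  | zero =>
    have h : HasDerivAt (fun z => (z - x) * w z) (1 * w x + (x - x) * deriv w x) x :=
      ((hasDerivAt_id x).sub_const x).mul hw.differentiableAt.hasDerivAt
    simpa using h.deriv
  | succ n ih =>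
    have hd : deriv (fun z => (z - x) * w z) =ᶠ[𝓝 x] fun z => w z + (z - x) * deriv w z := by
      filter_upwards [hw.eventually_analyticAt] with z hz
      have h : HasDerivAt (fun z => (z - x) * w z) (1 * w z + (z - x) * deriv w z) z :=
        ((hasDerivAt_id z).sub_const x).mul hz.differentiableAt.hasDerivAt
      simpa using h.deriv
    have hdw : AnalyticAt ℝ (deriv w) x := hw.deriv
    rw [iteratedDeriv_succ', hd.iteratedDeriv_eq,
      iteratedDeriv_fun_add hw.contDiffAt
        (by fun_prop : AnalyticAt ℝ (fun z => (z - x) * deriv w z) x).contDiffAt,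
      ih hdw, ← iteratedDeriv_succ']
    push_cast
    ring

theorem AnalyticAt.dslope_self {Q : ℝ → ℝ} {x : ℝ} (hQ : AnalyticAt ℝ Q x) :
    AnalyticAt ℝ (dslope Q x) x := by
  obtain ⟨p, hp⟩ := hQ
  exact ⟨_, hp.has_fpower_series_dslope_fslope⟩

/-- Lagrange inversion at a regular point: if each `U (m + 1)` is the derivative of `U m` with
respect to `Q`, the `n`-th derivative of `Q' U₀ ((z - x) / (Q z - Q x)) ^ (n + 1)` at `x` is
`Uₙ x`. -/
theorem iteratedDeriv_deriv_mul_div_dslope_pow {Q : ℝ → ℝ} {x : ℝ} (hQ : AnalyticAt ℝ Q x)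
    (hQx : deriv Q x ≠ 0) {U : ℕ → ℝ → ℝ} (hU : ∀ m, AnalyticAt ℝ (U m) x)
    (hDU : ∀ m, ∀ᶠ z in 𝓝 x, deriv (U m) z = deriv Q z * U (m + 1) z) (n m : ℕ) :
    iteratedDeriv n (fun z => deriv Q z * U m z / dslope Q x z ^ (n + 1)) x = U (m + n) x := by
  have hS : AnalyticAt ℝ (dslope Q x) x := hQ.dslope_self
  have hSx : dslope Q x x ≠ 0 := by rwa [dslope_same]
  induction n generalizing m with
  | zero => simp [hQx]
  | succ n ih =>
    set S := dslope Q x with hSdef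
    have hUm := hU m
    have hU' := (hU m).deriv
    have hv : AnalyticAt ℝ (fun z => U m z / S z ^ (n + 1)) x :=
      hUm.fun_div (hS.fun_pow _) (pow_ne_zero _ hSx)
    have hw : AnalyticAt ℝ (fun z => deriv (U m) z / S z ^ (n + 1)) x :=
      hU'.fun_div (hS.fun_pow _) (pow_ne_zero _ hSx)
    have hv' := hv.deriv
    have hF : AnalyticAt ℝ (fun z => deriv Q z * U m z / S z ^ (n + 1 + 1)) x :=
      (hQ.deriv.fun_mul hUm).fun_div (hS.fun_pow _) (pow_ne_zero _ hSx)
    have hQS : ∀ z, Q z = Q x + (z - x) * S z := fun z => by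
      have := sub_smul_dslope Q x z
      simp only [smul_eq_mul] at this
      rw [hSdef, this]; ring
    have key : (fun z => ((n : ℝ) + 1) * (deriv Q z * U m z / S z ^ (n + 1 + 1))) =ᶠ[𝓝 x]
        fun z => ((n : ℝ) + 1) * (U m z / S z ^ (n + 1)) +
          (z - x) * (deriv (U m) z / S z ^ (n + 1) - deriv (fun z => U m z / S z ^ (n + 1)) z) := by
      filter_upwards [hS.eventually_analyticAt, hUm.eventually_analyticAt,
        hS.continuousAt.eventually_ne hSx] with z hSz hUz hz
      have hSd := hSz.differentiableAt.hasDerivAt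
      have hUd := hUz.differentiableAt.hasDerivAt
      have hQd : deriv Q z = S z + (z - x) * deriv S z := by
        have h : HasDerivAt (fun z => Q x + (z - x) * S z) (1 * S z + (z - x) * deriv S z) z :=
          (((hasDerivAt_id z).sub_const x).mul hSd).const_add _
        rw [funext hQS, h.deriv, one_mul]
      have hvd : deriv (fun z => U m z / S z ^ (n + 1)) z = _ :=
        (hUd.fun_div (hSd.fun_pow (n + 1)) (pow_ne_zero _ hz)).deriv
      rw [hvd, hQd]
      push_cast
      field_simp
      ring
    have e := key.iteratedDeriv_eq (n + 1)
    rw [iteratedDeriv_const_mul _ hF.contDiffAt,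
      iteratedDeriv_fun_add (analyticAt_const.fun_mul hv).contDiffAt
        (by fun_prop : AnalyticAt ℝ (fun z => (z - x) * (deriv (U m) z / S z ^ (n + 1) -
          deriv (fun z => U m z / S z ^ (n + 1)) z)) x).contDiffAt,
      iteratedDeriv_const_mul _ hv.contDiffAt,
      iteratedDeriv_succ_sub_mul_self (hw.fun_sub hv') n,
      iteratedDeriv_fun_sub hw.contDiffAt hv'.contDiffAt, ← iteratedDeriv_succ'] at e
    have e2 : iteratedDeriv n (fun z => deriv (U m) z / S z ^ (n + 1)) x = U (m + (n + 1)) x := by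
      rw [show m + (n + 1) = m + 1 + n by ring, ← ih (m + 1)]
      refine Filter.EventuallyEq.iteratedDeriv_eq n ?_
      filter_upwards [hDU m] with z hz
      rw [hz]
    rw [e2] at e
    have hn : (n : ℝ) + 1 ≠ 0 := by positivity
    apply mul_left_cancel₀ hn
    rw [e]
    ring

theorem analyticAt_rpow_const_of_pos {x : ℝ} (hx : 0 < x) (p : ℝ) :
    AnalyticAt ℝ (fun z : ℝ => z ^ p) x := by
  have h : AnalyticAt ℝ (fun z : ℝ => Real.exp (Real.log z * p)) x :=
    ((analyticAt_log hx).fun_mul analyticAt_const).rexp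
  refine h.congr ?_
  filter_upwards [lt_mem_nhds hx] with z hz
  rw [Real.rpow_def_of_pos hz]

/-- A primitive of `c z ^ p exp (b / z)` on the positive half-line is analytic. -/
theorem analyticAt_of_hasDerivAt_rpow_mul_exp {Q : ℝ → ℝ} {b c p x : ℝ} (hx : 0 < x)
    (hQ : ∀ z, 0 < z → HasDerivAt Q (c * z ^ p * Real.exp (b / z)) z) :
    AnalyticAt ℝ Q x := by
  set q : ℂ → ℂ := fun z => c * Complex.exp (Complex.log z * p) * Complex.exp (b / z)
  have hre : ∀ z ∈ Metric.ball (x : ℂ) x, 0 < z.re := fun z hz => by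
    have h1 := (Complex.abs_re_le_norm (z - x)).trans_lt (mem_ball_iff_norm.1 hz)
    rw [Complex.sub_re, Complex.ofReal_re] at h1
    linarith [(abs_lt.1 h1).1]
  have hq : DifferentiableOn ℂ q (Metric.ball (x : ℂ) x) := by
    intro z hz
    have hz0 := hre z hz
    have hz' : z ≠ 0 := by rintro rfl; simp at hz0
    have hlog := (Complex.hasDerivAt_log (Or.inl hz0)).differentiableAt
    have : DifferentiableAt ℂ q z := by
      refine DifferentiableAt.mul (DifferentiableAt.const_mul (hlog.mul_const _).cexp _) ?_
      exact ((differentiableAt_const _).div differentiableAt_id hz').cexp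
    exact this.differentiableWithinAt
  obtain ⟨G, hG⟩ := hq.isExactOn_ball
  have hGa : AnalyticAt ℂ G x :=
    (show DifferentiableOn ℂ G (Metric.ball (x : ℂ) x) from
      fun z hz => (hG z hz).differentiableAt.differentiableWithinAt).analyticAt
      (Metric.ball_mem_nhds _ hx)
  have hRa := hGa.re_ofReal
  have hmem : ∀ z ∈ Metric.ball x x, (z : ℂ) ∈ Metric.ball (x : ℂ) x := fun z hz => by
    rw [mem_ball_iff_norm] at hz ⊢
    rwa [← Complex.ofReal_sub, Complex.norm_real]
  have hR : ∀ z ∈ Metric.ball x x,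
      HasDerivAt (fun t : ℝ => (G t).re) (c * z ^ p * Real.exp (b / z)) z := fun z hz => by
    have hz0 : 0 < z := by simpa using hre z (hmem z hz)
    have h := (hG z (hmem z hz)).real_of_complex
    convert h using 1
    have : q z = ((c * z ^ p * Real.exp (b / z) : ℝ) : ℂ) := by
      simp only [q, Real.rpow_def_of_pos hz0]
      push_cast [Complex.ofReal_log hz0.le]
      rfl
    rw [this, Complex.ofReal_re]
  have hpos : ∀ z ∈ Metric.ball x x, 0 < z := fun z hz => by
    simpa using hre z (hmem z hz)
  refine (hRa.fun_add (analyticAt_const (v := Q x - (G x).re))).congr ?_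
  filter_upwards [Metric.ball_mem_nhds x hx] with z hz
  have hconst := (convex_ball x x).is_const_of_fderivWithin_eq_zero (𝕜 := ℝ)
    (f := fun t : ℝ => Q t - (G t).re)
    (fun t ht => ((hQ t (hpos t ht)).sub (hR t ht)).differentiableAt.differentiableWithinAt)
    (fun t ht => by
      have h := (hQ t (hpos t ht)).sub (hR t ht)
      rw [sub_self] at h
      have h' := h.hasFDerivAt.hasFDerivWithinAt (s := Metric.ball x x)
      have := h'.fderivWithin (Metric.isOpen_ball.uniqueDiffWithinAt ht)
      rw [show (fun t : ℝ => Q t - (G t).re) = Q - fun t : ℝ => (G t).re from rfl, this]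
      simp) hz (Metric.mem_ball_self hx)
  linarith

/-- The series of the Type III inverse function, differentiated termwise. -/
theorem hasDerivAt_tsum_rpow_of_log {r a b : ℝ} {Q : ℝ → ℝ}
    (hQ : ∀ x : ℝ, Q x = ∑' k : ℕ,
      (if (k : ℝ) = -1 - a
        then (r ^ k / ((k.factorial : ℝ) * b)) * Real.log x
        else -((r ^ k / ((k.factorial : ℝ) * b)) * (1 / ((k : ℝ) + 1 + a))
              * x ^ (-((k : ℝ) + 1 + a)))))
    {y : ℝ} (hy : 0 < y) :
    HasDerivAt Q (b⁻¹ * y ^ (-(2 + a)) * Real.exp (r / y)) y := by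
  have hsplit : ∀ z : ℝ, 0 < z → ∀ (k : ℕ) (s : ℝ),
      z ^ (-((k : ℝ) + s)) = z ^ (-s) * (1 / z) ^ k := fun z hz k s => by
    rw [neg_add, add_comm, Real.rpow_add hz, Real.rpow_neg hz.le (k : ℝ), Real.rpow_natCast,
      one_div, inv_pow]
  have hexp : ∀ t : ℝ, Summable fun k : ℕ => t ^ k / (k.factorial : ℝ) :=
    Real.summable_pow_div_factorial
  set g' : ℕ → ℝ → ℝ := fun k z => r ^ k / ((k.factorial : ℝ) * b) * z ^ (-((k : ℝ) + (2 + a)))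
    with hg'
  have hsum : ∑' k, g' k y = b⁻¹ * y ^ (-(2 + a)) * Real.exp (r / y) := by
    rw [Real.exp_eq_exp_ℝ, NormedSpace.exp_eq_tsum_div (𝔸 := ℝ), ← tsum_mul_left]
    refine tsum_congr fun k => ?_
    simp only [hg']
    rw [hsplit y hy]
    simp only [div_eq_mul_inv, mul_inv, mul_pow, one_mul]
    ring
  rw [← hsum, funext hQ]
  set t := Ioo (y / 2) (2 * y)
  have htpos : ∀ z ∈ t, 0 < z := fun z hz => (half_pos hy).trans hz.1
  obtain ⟨M, hM⟩ := (isCompact_Icc (a := y / 2) (b := 2 * y)).exists_bound_of_continuousOn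
    (f := fun z : ℝ => z ^ (-(2 + a)))
    (fun z hz => (Real.continuousAt_rpow_const z _
      (Or.inl ((half_pos hy).trans_le hz.1).ne')).continuousWithinAt)
  have hyt : y ∈ t := ⟨by linarith, by linarith⟩
  refine hasDerivAt_tsum_of_isPreconnected (𝕜 := ℝ) (F := ℝ) (g' := g') (t := t) (y₀ := y)
    (u := fun k => |b|⁻¹ * M * ((|r| * (2 / y)) ^ k / (k.factorial : ℝ)))
    ((hexp (|r| * (2 / y))).mul_left (|b|⁻¹ * M)) isOpen_Ioo isPreconnected_Ioo ?_ ?_ hyt ?_ hyt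
  · intro k z hz
    have hz0 := htpos z hz
    simp only [hg']
    split_ifs with hk
    · have h := (Real.hasDerivAt_log hz0.ne').const_mul (r ^ k / ((k.factorial : ℝ) * b))
      rwa [hk, show -(-1 - a + (2 + a)) = (-1 : ℝ) by ring, Real.rpow_neg_one]
    · have hk' : (k : ℝ) + 1 + a ≠ 0 := fun h => hk (by linarith)
      have h := ((Real.hasDerivAt_rpow_const (p := -((k : ℝ) + 1 + a)) (Or.inl hz0.ne')).const_mul
        (r ^ k / ((k.factorial : ℝ) * b) * (1 / ((k : ℝ) + 1 + a)))).fun_neg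
      convert h using 1
      rw [show -((k : ℝ) + 1 + a) - 1 = -((k : ℝ) + (2 + a)) by ring]
      field_simp
  · intro k z hz
    have hz0 := htpos z hz
    simp only [hg']
    rw [hsplit z hz0, norm_mul, norm_mul, norm_div, norm_mul, norm_pow, norm_pow]
    have h1 : ‖z ^ (-(2 + a))‖ ≤ M := hM z ⟨hz.1.le, hz.2.le⟩
    have h2 : ‖1 / z‖ ≤ 2 / y := by
      rw [Real.norm_of_nonneg (by positivity), div_le_div_iff₀ hz0 hy]
      linarith [hz.1]
    have h3 : ‖z ^ (-(2 + a))‖ * ‖1 / z‖ ^ k ≤ M * (2 / y) ^ k := by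
      have := (norm_nonneg _).trans h1
      gcongr
    calc _ ≤ ‖r‖ ^ k / (‖(k.factorial : ℝ)‖ * ‖b‖) * (M * (2 / y) ^ k) := by gcongr
      _ = _ := by
        rw [Real.norm_natCast, Real.norm_eq_abs, Real.norm_eq_abs, mul_pow, div_eq_mul_inv,
          mul_inv]
        ring
  · refine Summable.of_norm_bounded_eventually_nat
      (g := fun k : ℕ => |b|⁻¹ * y ^ (-(1 + a)) * ((|r| * (1 / y)) ^ k / (k.factorial : ℝ)))
      ((hexp (|r| * (1 / y))).mul_left (|b|⁻¹ * y ^ (-(1 + a)))) ?_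
    filter_upwards [eventually_gt_atTop ⌈-a⌉₊] with k hk
    have hk : -a < (k : ℝ) := Nat.lt_of_ceil_lt hk
    rw [if_neg (fun h => by linarith)]
    have h1 : ‖1 / ((k : ℝ) + 1 + a)‖ ≤ 1 := by
      rw [Real.norm_of_nonneg (one_div_nonneg.2 (by linarith)), div_le_one (by linarith)]
      linarith
    rw [add_assoc (k : ℝ), hsplit y hy, ← add_assoc, norm_neg, norm_mul, norm_mul, norm_div,
      norm_mul, norm_pow, Real.norm_of_nonneg (by positivity : 0 ≤ y ^ (-(1 + a)) * (1 / y) ^ k)]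
    calc _ ≤ ‖r‖ ^ k / (‖(k.factorial : ℝ)‖ * ‖b‖) * 1 * (y ^ (-(1 + a)) * (1 / y) ^ k) := by
          gcongr
      _ = _ := by
        rw [Real.norm_natCast, Real.norm_eq_abs, Real.norm_eq_abs, mul_pow, div_eq_mul_inv,
          mul_inv]
        ring

section GKP

variable {α α' β' γ γ' : ℝ} {A : ℕ → ℕ → ℝ}

theorem gkp_eq_zero_of_lt (h0k : ∀ k : ℕ, A 0 (k + 1) = 0)
    (hnk : ∀ n k : ℕ, A (n + 1) (k + 1) =
      (α * (n + 1) + γ) * A n (k + 1) + (α' * (n + 1) + β' * (k + 1) + γ') * A n k)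
    {n k : ℕ} (h : n < k) : A n k = 0 := by
  induction n generalizing k with
  | zero => obtain ⟨k, rfl⟩ := Nat.exists_eq_add_of_lt h; simpa using h0k _
  | succ n ih =>
    obtain ⟨k, rfl⟩ : ∃ j, k = j + 1 := ⟨k - 1, by omega⟩
    rw [hnk, ih (by omega), ih (by omega)]
    ring

/-- Differential recurrence for the row generating polynomials. -/
theorem gkp_row_succ (h0k : ∀ k : ℕ, A 0 (k + 1) = 0)
    (hn0 : ∀ n : ℕ, A (n + 1) 0 = (α * (n + 1) + γ) * A n 0)
    (hnk : ∀ n k : ℕ, A (n + 1) (k + 1) =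
      (α * (n + 1) + γ) * A n (k + 1) + (α' * (n + 1) + β' * (k + 1) + γ') * A n k)
    (n : ℕ) (x : ℝ) :
    ∑ k ∈ Finset.range (n + 2), A (n + 1) k * x ^ k =
      ((α * (n + 1) + γ) + (α' * (n + 1) + γ' + β') * x) *
          ∑ k ∈ Finset.range (n + 1), A n k * x ^ k
        + β' * x ^ 2 * ∑ k ∈ Finset.range (n + 1), A n k * (k * x ^ (k - 1)) := by
  have hshift : ∑ k ∈ Finset.range (n + 1), A n (k + 1) * x ^ (k + 1) + A n 0 * x ^ 0 =
      ∑ k ∈ Finset.range (n + 1), A n k * x ^ k := by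
    rw [← Finset.sum_range_succ' (fun k => A n k * x ^ k), Finset.sum_range_succ,
      gkp_eq_zero_of_lt h0k hnk n.lt_succ_self]
    ring
  have hterm : ∀ k : ℕ, A (n + 1) (k + 1) * x ^ (k + 1) =
      (α * (n + 1) + γ) * (A n (k + 1) * x ^ (k + 1)) +
      ((α' * (n + 1) + γ' + β') * x * (A n k * x ^ k) +
        β' * x ^ 2 * (A n k * (k * x ^ (k - 1)))) := fun k => by
    rw [hnk]
    rcases k with _ | k
    · push_cast; ring
    · push_cast
      ring
  rw [Finset.sum_range_succ', Finset.sum_congr rfl fun k _ => hterm k, Finset.sum_add_distrib,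
    Finset.sum_add_distrib, ← Finset.mul_sum, ← Finset.mul_sum, ← Finset.mul_sum, hn0, add_mul,
    ← hshift]
  ring

end GKP

/-- `d/dz (c z ^ p exp (-s / (b z)) P(z))` for `z > 0`. -/
theorem hasDerivAt_rpow_mul_exp_mul {b p s z P' : ℝ} (hb : b ≠ 0) (hz : 0 < z) {P : ℝ → ℝ}
    (hP : HasDerivAt P P' z) :
    HasDerivAt (fun z => b * z ^ p * Real.exp (-(s / (b * z))) * P z)
      (z ^ (p - 2) * Real.exp (-(s / (b * z))) * ((b * p * z + s) * P z + b * z ^ 2 * P')) z := by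
  have h1 := (Real.hasDerivAt_rpow_const (p := p) (Or.inl hz.ne')).const_mul b
  have h2 := (((hasDerivAt_id z).const_mul b).fun_inv (mul_ne_zero hb hz.ne')).const_mul (-s)
  have h3 := (h1.fun_mul h2.exp).fun_mul hP
  have e1 : z ^ (p - 1) = z ^ (p - 2) * z := by
    rw [← Real.rpow_add_one hz.ne']; congr 1; ring
  have e2 : z ^ p = z ^ (p - 2) * z ^ 2 := by
    rw [← Real.rpow_natCast z 2, ← Real.rpow_add hz]; congr 1; push_cast; ring
  have e3 : ∀ y : ℝ, -(s / (b * y)) = -s * (b * id y)⁻¹ := fun y => by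
    rw [id, div_eq_mul_inv, neg_mul]
  simp only [e3]
  refine h3.congr_deriv ?_
  rw [e1, e2]
  simp only [id]
  field_simp

open Real Topology in
/-- Residue formula for Type III row polynomials: with Q = G⁻¹_{α,α',β'} and
f(z) = z^{γ'/β'−1}exp(−γ/(β'z))(z−x)^{n+1}/(Q(z)−Q(x))^{n+1}, the n-th derivative of f
tends to β'·x^{1+((n+1)α'+γ')/β'}·exp(−((n+1)α+γ)/(β'x))·P_n(x) as z → x, z ≠ x. -/
theorem stmt_16 (α β γ α' β' γ' : ℝ) (hβ : β = 0) (hβ' : β' ≠ 0) (A : ℕ → ℕ → ℝ)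
    (h00 : A 0 0 = 1)
    (h0k : ∀ k : ℕ, A 0 (k + 1) = 0)
    (hn0 : ∀ n : ℕ, A (n + 1) 0 = (α * (n + 1) + γ) * A n 0)
    (hnk : ∀ n k : ℕ, A (n + 1) (k + 1) =
      (α * (n + 1) + β * (k + 1) + γ) * A n (k + 1)
        + (α' * (n + 1) + β' * (k + 1) + γ') * A n k)
    (Q : ℝ → ℝ)
    (hQ : ∀ x : ℝ, Q x = ∑' k : ℕ,
      (if (k : ℝ) = -1 - α' / β'
        then ((α / β') ^ k / ((k.factorial : ℝ) * β')) * Real.log x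
        else -(((α / β') ^ k / ((k.factorial : ℝ) * β')) * (1 / ((k : ℝ) + 1 + α' / β'))
              * x ^ (-((k : ℝ) + 1 + α' / β')))))
    (x : ℝ) (hx : 0 < x) (n : ℕ) (f : ℝ → ℝ)
    (hf : ∀ z : ℝ, f z = z ^ (γ' / β' - 1) * Real.exp (-γ / (β' * z)) * (z - x) ^ (n + 1)
        / (Q z - Q x) ^ (n + 1)) :
    Filter.Tendsto (iteratedDeriv n f) (𝓝[≠] x)
      (𝓝 (β' * x ^ (1 + (((n : ℝ) + 1) * α' + γ') / β')
            * Real.exp (-((((n : ℝ) + 1) * α + γ) / (β' * x)))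
            * ∑ k ∈ Finset.range (n + 1), A n k * x ^ k)) := by
  subst hβ
  have hnk' : ∀ n k : ℕ, A (n + 1) (k + 1) =
      (α * (n + 1) + γ) * A n (k + 1) + (α' * (n + 1) + β' * (k + 1) + γ') * A n k :=
    fun n k => by rw [hnk]; ring
  have hQd : ∀ z, 0 < z →
      HasDerivAt Q (β'⁻¹ * z ^ (-(2 + α' / β')) * Real.exp (α / β' / z)) z :=
    fun z hz => hasDerivAt_tsum_rpow_of_log hQ hz
  have hQa : AnalyticAt ℝ Q x := analyticAt_of_hasDerivAt_rpow_mul_exp hx hQd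
  have hQx : deriv Q x ≠ 0 := by
    rw [(hQd x hx).deriv]
    have := Real.rpow_pos_of_pos hx (-(2 + α' / β'))
    have := Real.exp_pos (α / β' / x)
    positivity
  set U : ℕ → ℝ → ℝ := fun m z => β' * z ^ (1 + (((m : ℝ) + 1) * α' + γ') / β')
    * Real.exp (-((((m : ℝ) + 1) * α + γ) / (β' * z)))
    * ∑ k ∈ Finset.range (m + 1), A m k * z ^ k with hUdef
  have hUa : ∀ m, AnalyticAt ℝ (U m) x := fun m => by
    refine (((analyticAt_const.fun_mul (analyticAt_rpow_const_of_pos hx _)).fun_mul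
      (AnalyticAt.rexp ?_)).fun_mul ?_)
    · exact (analyticAt_const.fun_div (analyticAt_const.fun_mul analyticAt_id)
        (mul_ne_zero hβ' hx.ne')).fun_neg
    · exact Finset.analyticAt_fun_sum _ fun k _ => analyticAt_const.fun_mul (analyticAt_id.fun_pow k)
  have hUd : ∀ m, ∀ᶠ z in 𝓝 x, deriv (U m) z = deriv Q z * U (m + 1) z := fun m => by
    filter_upwards [lt_mem_nhds hx] with z hz
    have hP : HasDerivAt (fun z => ∑ k ∈ Finset.range (m + 1), A m k * z ^ k)
        (∑ k ∈ Finset.range (m + 1), A m k * (k * z ^ (k - 1))) z :=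
      HasDerivAt.fun_sum fun k _ => (hasDerivAt_pow k z).const_mul _
    rw [(hasDerivAt_rpow_mul_exp_mul hβ' hz hP).deriv, (hQd z hz).deriv]
    simp only [hUdef]
    rw [gkp_row_succ h0k hn0 hnk']
    have e1 : z ^ (1 + (((m : ℝ) + 1) * α' + γ') / β' - 2) =
        z ^ (-(2 + α' / β')) * z ^ (1 + ((((m + 1 : ℕ) : ℝ) + 1) * α' + γ') / β') := by
      rw [← Real.rpow_add hz]; congr 1; push_cast; field_simp; ring
    have e2 : Real.exp (-((((m : ℝ) + 1) * α + γ) / (β' * z))) =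
        Real.exp (α / β' / z) * Real.exp (-(((((m + 1 : ℕ) : ℝ) + 1) * α + γ) / (β' * z))) := by
      rw [← Real.exp_add]; congr 1; push_cast; field_simp; ring
    rw [e1, e2]
    field_simp
    ring
  set F : ℝ → ℝ := fun z => deriv Q z * U 0 z / dslope Q x z ^ (n + 1) with hFdef
  have hFa : AnalyticAt ℝ F x :=
    (hQa.deriv.fun_mul (hUa 0)).fun_div (hQa.dslope_self.fun_pow _)
      (pow_ne_zero _ (by rwa [dslope_same]))
  have hfF : ∀ᶠ z in 𝓝[≠] x, f z = F z := by
    filter_upwards [self_mem_nhdsWithin, nhdsWithin_le_nhds (lt_mem_nhds hx)] with z hzx hz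
    have hzx' : z - x ≠ 0 := sub_ne_zero.2 hzx
    rw [hf, hFdef]
    simp only [hUdef]
    rw [(hQd z hz).deriv, dslope_of_ne _ hzx, slope_def_field, div_pow]
    have e1 : z ^ (γ' / β' - 1) =
        z ^ (-(2 + α' / β')) * z ^ (1 + ((((0 : ℕ) : ℝ) + 1) * α' + γ') / β') := by
      rw [← Real.rpow_add hz]; congr 1; push_cast; field_simp; ring
    have e2 : Real.exp (-γ / (β' * z)) =
        Real.exp (α / β' / z) * Real.exp (-(((((0 : ℕ) : ℝ) + 1) * α + γ) / (β' * z))) := by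
      rw [← Real.exp_add]; congr 1; push_cast; field_simp; ring
    rw [e1, e2, div_div_eq_mul_div]
    simp only [zero_add, Finset.sum_range_one, h00, pow_zero, mul_one]
    field_simp
  have hFn := iteratedDeriv_deriv_mul_div_dslope_pow hQa hQx hUa hUd n 0
  rw [zero_add] at hFn
  have hcont : Tendsto (iteratedDeriv n F) (𝓝[≠] x) (𝓝 (U n x)) := by
    rw [← hFn, iteratedDeriv_eq_iterate]
    exact (hFa.iterated_deriv n).continuousAt.tendsto.mono_left nhdsWithin_le_nhds
  refine hcont.congr' ?_
  filter_upwards [eventually_eventually_nhdsWithin.2 hfF, self_mem_nhdsWithin] with z hz hzx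
  rw [nhdsWithin_eq_nhds.2 (isOpen_compl_singleton.mem_nhds hzx)] at hz
  exact (Filter.EventuallyEq.iteratedDeriv_eq n hz).symm
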